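/- arXiv:1106.3058 — 6 statements merged into one kernel-verified Lean document; each statement's English description precedes it below -/
import Mathlib

section
/- Let H be a complex Hilbert space, let T be an invertible bounded linear operator on H that is log-hyponormal, and let T = U|T| be the polar decomposition of T, so U is unitary. If U^{n_0} = U* for some positive integer n_0, then T is normal. -/
open ContinuousLinearMap

/-- If `T` is an invertible log-hyponormal operator with polar decomposition `T = U|T|`
(`U` unitary) and `U ^ n₀ = U*` for some positive integer `n₀`, then `T` is normal. -/
theorem normal_of_log_hyponormal_of_pow_eq_adjoint
    {H : Type*} [NormedAddCommGroup H] [InnerProductSpace ℂ H] [CompleteSpace H]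
    (T U R : H →L[ℂ] H)
    (hT_inv : IsUnit T)
    (hR_pos : 0 ≤ R) (hR_sq : R * R = adjoint T * T)
    (hpolar : T = U * R)
    (hU_unitary : adjoint U * U = 1 ∧ U * adjoint U = 1)
    (hhyp : CFC.log (T * adjoint T) ≤ CFC.log (adjoint T * T))
    (n₀ : ℕ) (hn₀ : 0 < n₀) (hU : U ^ n₀ = adjoint U) :
    adjoint T * T = T * adjoint T := by
  obtain ⟨hU1, hU2⟩ := hU_unitary
  simp only [← ContinuousLinearMap.star_eq_adjoint] at *
  have hRs : star R = R := (IsSelfAdjoint.of_nonneg hR_pos).star_eq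
  have hTT : T * star T = U * (star T * T) * star U := by
    rw [← hR_sq, hpolar, star_mul, hRs]; simp only [mul_assoc]
  have hP : IsStrictlyPositive (star T * T) :=
    ⟨star_mul_self_nonneg T, hT_inv.star.mul hT_inv⟩
  have hQ : IsStrictlyPositive (T * star T) :=
    ⟨mul_star_self_nonneg T, hT_inv.mul hT_inv.star⟩
  have hA := CFC.exp_log (star T * T) hP
  have hB := CFC.exp_log (T * star T) hQ
  have hAs : IsSelfAdjoint (CFC.log (star T * T)) := IsSelfAdjoint.log
  set A := CFC.log (star T * T) with hAdef
  have hlog : CFC.log (T * star T) = U * A * star U := by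
    let u : (H →L[ℂ] H)ˣ := ⟨U, star U, hU2, hU1⟩
    letI : NormedAlgebra ℚ (H →L[ℂ] H) := NormedAlgebra.restrictScalars ℚ ℂ (H →L[ℂ] H)
    have h := NormedSpace.exp_units_conj u A
    change NormedSpace.exp (U * A * star U) = U * NormedSpace.exp A * star U at h
    rw [hTT, ← hA, ← h]
    exact CFC.log_exp _ (hAs.conjugate U)
  rw [hlog] at hhyp hB
  have key : ∀ k : ℕ, U ^ (k+1) * A * star (U ^ (k+1)) ≤ U * A * star U := by
    intro k
    induction k with
    | zero => simp
    | succ k ih =>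
      have h1 := star_right_conjugate_le_conjugate (ih.trans hhyp) U
      rw [pow_succ' U (k+1), star_mul]
      simpa only [mul_assoc] using h1
  have h1 := key n₀
  rw [pow_succ, hU, hU1] at h1
  simp only [star_one, one_mul, mul_one] at h1
  rw [← hA, ← hB, le_antisymm hhyp h1]
end

section
/- Let H be a complex Hilbert space, let T be an invertible bounded linear operator on H with polar decomposition T = U|T| (U unitary), and suppose that the spectrum of U is contained in some open semicircle of the unit circle, i.e., there exist a real number α and ε > 0 such that sp(U) ⊆ { e^{iλ} : α + ε < λ < α + π − ε }. Then the Aluthge transform T̃ = |T|^{1/2} U |T|^{1/2} is normal if and only if T is normal. -/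
open ContinuousLinearMap

open scoped ComplexOrder in
/-- `wU + (wU)*` is positive and invertible if `wU` has spectrum in the right half plane. -/
theorem aux_pos {H : Type*} [NormedAddCommGroup H] [InnerProductSpace ℂ H] [CompleteSpace H]
    (U : H →L[ℂ] H) (hU : adjoint U * U = 1 ∧ U * adjoint U = 1)
    (w : ℂ) (hspec : ∀ z ∈ spectrum ℂ U, 0 < (w * z).re) :
    0 ≤ w • U + star w • adjoint U ∧ IsUnit (w • U + star w • adjoint U) := by
  have hn : IsStarNormal U := ⟨by
    rw [ContinuousLinearMap.star_eq_adjoint]; exact hU.1.trans hU.2.symm⟩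
  have hA : w • U + star w • adjoint U = cfc (fun z : ℂ => w * z + star w * star z) U := by
    rw [cfc_add (a := U) (fun z : ℂ => w * z) (fun z : ℂ => star w * star z) ,
      cfc_const_mul _ _ _, cfc_const_mul _ _ _ , cfc_star_id (R := ℂ) (a := U), cfc_id' ℂ U]
    rfl
  have hre : ∀ z : ℂ, w * z + star w * star z = ((2 * (w * z).re : ℝ) : ℂ) := by
    intro z
    have := Complex.add_conj (w * z)
    simpa using this
  rw [hA]
  constructor
  · apply cfc_nonneg
    intro z hz
    rw [hre]
    have := hspec z hz
    exact_mod_cast (by positivity)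
  · rw [isUnit_cfc_iff _ _]
    intro z hz
    rw [hre]
    have := hspec z hz
    exact_mod_cast (by positivity)

/-- An operator commuting with the square of a positive operator commutes with it. -/
theorem aux_commute_of_sq {H : Type*} [NormedAddCommGroup H] [InnerProductSpace ℂ H]
    [CompleteSpace H] (A B : H →L[ℂ] H) (hA : 0 ≤ A) (h : Commute (A * A) B) :
    Commute A B := by
  have h1 : CFC.sqrt (A * A) = A := CFC.sqrt_mul_self A hA
  rw [← h1]
  exact h.cfcₙ_nnreal _

/-- Core step: commuting with `U²` implies commuting with `U`. -/
theorem aux_commute {H : Type*} [NormedAddCommGroup H] [InnerProductSpace ℂ H] [CompleteSpace H]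
    (U R : H →L[ℂ] H) (hU : adjoint U * U = 1 ∧ U * adjoint U = 1)
    (w : ℂ) (hw : w * star w = 1) (hspec : ∀ z ∈ spectrum ℂ U, 0 < (w * z).re)
    (h : Commute (U * U) R) : Commute U R := by
  obtain ⟨hpos, hunit⟩ := aux_pos U hU w hspec
  obtain ⟨h1, h2⟩ := hU
  set W := adjoint U with hW
  have hWR : Commute (W * W) R := by
    have e1 : W * W * (U * U) = 1 := by
      rw [mul_assoc, ← mul_assoc W U U, h1, one_mul, h1]
    have e2 : U * U * (W * W) = 1 := by
      rw [mul_assoc, ← mul_assoc U W W, h2, one_mul, h2]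
    calc W * W * R = W * W * R * (U * U * (W * W)) := by rw [e2, mul_one]
      _ = W * W * (R * (U * U)) * (W * W) := by simp only [mul_assoc]
      _ = (W * W * (U * U)) * R * (W * W) := by rw [← h.eq]; simp only [mul_assoc]
      _ = R * (W * W) := by rw [e1, one_mul]
  have hw' : star w * w = 1 := by rw [mul_comm, hw]
  set A := w • U + star w • W with hA
  have hAA : A * A = (w * w) • (U * U) + (2 : ℂ) • 1 + (star w * star w) • (W * W) := by
    rw [hA]
    simp only [mul_add, add_mul, smul_mul_smul_comm, h1, h2, hw, hw']
    module
  have hUA : U * A = w • (U * U) + star w • 1 := by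
    rw [hA]; simp only [mul_add, mul_smul_comm, h2]
  have hcA : Commute A R := by
    apply aux_commute_of_sq A R hpos
    rw [hAA]
    exact ((h.smul_left _).add_left ((Commute.one_left R).smul_left _)).add_left
      (hWR.smul_left _)
  have hcUA : Commute (U * A) R := by
    rw [hUA]
    exact (h.smul_left _).add_left ((Commute.one_left R).smul_left _)
  apply hunit.mul_right_cancel
  calc U * R * A = U * A * R := by rw [mul_assoc, ← hcA.eq, mul_assoc]
    _ = R * U * A := by rw [hcUA.eq, mul_assoc]


open ContinuousLinearMap

/-- Let `T` be invertible with polar decomposition `T = U|T|` (`U` unitary), and suppose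
the spectrum of `U` lies in an open semicircle `{e^{iλ} : α + ε < λ < α + π - ε}`.
Then the Aluthge transform `T̃ = |T|^{1/2} U |T|^{1/2}` is normal iff `T` is normal.
Here `R = |T|` and `Q = |T|^{1/2}`. -/
theorem aluthge_normal_iff_normal_of_spectrum_semicircle
    {H : Type*} [NormedAddCommGroup H] [InnerProductSpace ℂ H] [CompleteSpace H]
    (T U R Q : H →L[ℂ] H)
    (hT_inv : IsUnit T)
    (hR_pos : 0 ≤ R) (hR_sq : R * R = adjoint T * T)
    (hQ_pos : 0 ≤ Q) (hQ_sq : Q * Q = R)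
    (hpolar : T = U * R)
    (hU_unitary : adjoint U * U = 1 ∧ U * adjoint U = 1)
    (α ε : ℝ) (hε : 0 < ε)
    (hspec : spectrum ℂ U ⊆
      {z : ℂ | ∃ lam : ℝ, α + ε < lam ∧ lam < α + Real.pi - ε ∧ z = Complex.exp (lam * Complex.I)}) :
    (adjoint (Q * U * Q) * (Q * U * Q) = (Q * U * Q) * adjoint (Q * U * Q)) ↔
      (adjoint T * T = T * adjoint T) := by
  obtain ⟨h1, h2⟩ := hU_unitary
  have hRs : adjoint R = R := (IsSelfAdjoint.of_nonneg hR_pos).adjoint_eq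
  have hQs : adjoint Q = Q := (IsSelfAdjoint.of_nonneg hQ_pos).adjoint_eq
  have hadj : ∀ A B : H →L[ℂ] H, adjoint (A * B) = adjoint B * adjoint A := fun A B =>
    adjoint_comp A B
  have hUu : IsUnit U := ⟨⟨U, adjoint U, h2, h1⟩, rfl⟩
  have hRu : IsUnit R := by
    have hW : IsUnit (adjoint U) := ⟨⟨adjoint U, U, h1, h2⟩, rfl⟩
    have : R = adjoint U * T := by rw [hpolar, ← mul_assoc, h1, one_mul]
    rw [this]; exact hW.mul hT_inv
  have hQu : IsUnit Q := by
    rw [← hQ_sq, (Commute.refl Q).isUnit_mul_iff] at hRu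
    exact hRu.1
  have e1 : adjoint (Q * U * Q) * (Q * U * Q) = Q * (adjoint U * R * U) * Q := by
    simp only [hadj, hQs, ← hQ_sq, mul_assoc]
  have e2 : (Q * U * Q) * adjoint (Q * U * Q) = Q * (U * R * adjoint U) * Q := by
    simp only [hadj, hQs, ← hQ_sq, mul_assoc]
  have e3 : T * adjoint T = U * (R * R) * adjoint U := by
    rw [hpolar]; simp only [hadj, hRs, mul_assoc]
  rw [e1, e2, ← hR_sq, e3]
  constructor
  · intro h
    have h' : adjoint U * R * U = U * R * adjoint U :=
      hQu.mul_left_cancel (hQu.mul_right_cancel h)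
    have hc2 : Commute (U * U) R := by
      calc U * U * R = U * (U * R * adjoint U) * U := by
            simp only [mul_assoc, h1, mul_one]
        _ = (U * adjoint U) * R * (U * U) := by rw [← h']; simp only [mul_assoc]
        _ = R * (U * U) := by rw [h2, one_mul]
    have hc : Commute U R := by
      refine aux_commute U R ⟨h1, h2⟩
        (Complex.exp (((-(α + Real.pi / 2) : ℝ) : ℂ) * Complex.I)) ?_ ?_ hc2
      · have := Complex.mul_conj (Complex.exp (((-(α + Real.pi / 2) : ℝ) : ℂ) * Complex.I))
        rw [Complex.normSq_eq_norm_sq, Complex.norm_exp_ofReal_mul_I] at this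
        simpa using this
      · intro z hz
        obtain ⟨l, hl1, hl2, rfl⟩ := hspec hz
        rw [← Complex.exp_add, ← add_mul, ← Complex.ofReal_add, Complex.exp_ofReal_mul_I_re]
        apply Real.cos_pos_of_mem_Ioo
        constructor <;> linarith
    rw [(hc.mul_right hc).eq, mul_assoc, h2, mul_one]
  · intro h
    have hc : Commute (R * R) U := by
      change R * R * U = U * (R * R)
      calc R * R * U = U * (R * R) * adjoint U * U := by rw [← h]
        _ = U * (R * R) := by rw [mul_assoc, h1, mul_one]
    have hcR := aux_commute_of_sq R U hR_pos hc
    have f1 : adjoint U * R * U = R := by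
      rw [mul_assoc, hcR.eq, ← mul_assoc, h1, one_mul]
    have f2 : U * R * adjoint U = R := by
      rw [← hcR.eq, mul_assoc, h2, mul_one]
    rw [f1, f2]
end

section
/- Let H be a complex Hilbert space, let T be an invertible bounded linear operator on H with polar decomposition T = U|T| (U unitary), and suppose the Aluthge transform T̃ = |T|^{1/2} U |T|^{1/2} is normal. If X is a bounded linear operator on H with TX = XT, then U*|T| X = X U*|T|. -/
open ContinuousLinearMap

/-- Let `T` be invertible with polar decomposition `T = U|T|` (`U` unitary), and suppose
the Aluthge transform `T̃ = |T|^{1/2} U |T|^{1/2}` is normal. If `TX = XT`, then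
`U*|T| X = X U*|T|`. Here `R = |T|` and `Q = |T|^{1/2}`. -/
theorem adjoint_mul_abs_commutes_of_aluthge_normal
    {H : Type*} [NormedAddCommGroup H] [InnerProductSpace ℂ H] [CompleteSpace H]
    (T U R Q : H →L[ℂ] H)
    (hT_inv : IsUnit T)
    (hR_pos : 0 ≤ R) (hR_sq : R * R = adjoint T * T)
    (hQ_pos : 0 ≤ Q) (hQ_sq : Q * Q = R)
    (hpolar : T = U * R)
    (hU_unitary : adjoint U * U = 1 ∧ U * adjoint U = 1)
    (hnormal : adjoint (Q * U * Q) * (Q * U * Q) = (Q * U * Q) * adjoint (Q * U * Q))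
    (X : H →L[ℂ] H) (hX : T * X = X * T) :
    (adjoint U * R) * X = X * (adjoint U * R) := by
  obtain ⟨hU1, hU2⟩ := hU_unitary
  have hQsa : adjoint Q = Q := (IsSelfAdjoint.of_nonneg hQ_pos)
  have hUs : IsUnit (adjoint U) := isUnit_iff_exists.mpr ⟨U, hU1, hU2⟩
  have hR : R = adjoint U * T := by rw [hpolar, ← mul_assoc, hU1, one_mul]
  have hRu : IsUnit R := hR ▸ hUs.mul hT_inv
  have hQu : IsUnit Q := by
    have h : Commute Q Q := Commute.refl Q
    exact (h.isUnit_mul_iff.mp (hQ_sq ▸ hRu)).1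
  obtain ⟨P, hQP, hPQ⟩ := isUnit_iff_exists.mp hQu
  have hN : IsStarNormal (Q * U * Q) := ⟨hnormal⟩
  have hadj : star (Q * U * Q) = Q * adjoint U * Q := by
    have hQs : star Q = Q := hQsa
    rw [star_mul, star_mul, hQs, star_eq_adjoint, mul_assoc]
  have hX' : U * Q * Q * X = X * U * Q * Q := by
    rw [hpolar, ← hQ_sq] at hX
    simpa only [mul_assoc] using hX
  have hcomm : SemiconjBy (Q * X * P) (Q * U * Q) (Q * U * Q) := by
    change Q * X * P * (Q * U * Q) = Q * U * Q * (Q * X * P)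
    calc Q * X * P * (Q * U * Q) = Q * X * (P * Q) * U * Q * (Q * P) := by
          rw [hQP]; simp only [mul_assoc, mul_one]
      _ = Q * (X * U * Q * Q) * P := by rw [hPQ]; simp only [mul_assoc, one_mul]
      _ = Q * U * Q * (Q * X * P) := by rw [← hX']; simp only [mul_assoc]
  have hstar := fuglede_putnam_rosenblum hN hN hcomm
  rw [hadj] at hstar
  have h : Q * X * P * (Q * adjoint U * Q) = Q * adjoint U * Q * (Q * X * P) := hstar
  rw [← hQ_sq]
  calc adjoint U * (Q * Q) * X
      = P * (Q * adjoint U * Q * (Q * X * P)) * Q := by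
        have : P * (Q * adjoint U * Q * (Q * X * P)) * Q
          = (P * Q) * adjoint U * Q * Q * X * (P * Q) := by simp only [mul_assoc]
        rw [this, hPQ]; simp only [mul_assoc, one_mul, mul_one]
    _ = P * (Q * X * P * (Q * adjoint U * Q)) * Q := by rw [h]
    _ = (P * Q) * X * (P * Q) * adjoint U * Q * Q := by simp only [mul_assoc]
    _ = X * (adjoint U * (Q * Q)) := by rw [hPQ]; simp only [mul_assoc, one_mul, mul_one]
end

section
/- Let H be a complex Hilbert space, let T be an invertible bounded linear operator on H with polar decomposition T = U|T| (U unitary), and suppose the Aluthge transform T̃ = |T|^{1/2} U |T|^{1/2} is normal. If X is a bounded linear operator on H with TX = XT, then U^2 X = X U^2. -/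
open ContinuousLinearMap

/-- Let `T` be invertible with polar decomposition `T = U|T|` (`U` unitary), and suppose
the Aluthge transform `T̃ = |T|^{1/2} U |T|^{1/2}` is normal. If `TX = XT`, then
`U² X = X U²`. Here `R = |T|` and `Q = |T|^{1/2}`. -/
theorem sq_commutes_of_aluthge_normal
    {H : Type*} [NormedAddCommGroup H] [InnerProductSpace ℂ H] [CompleteSpace H]
    (T U R Q : H →L[ℂ] H)
    (hT_inv : IsUnit T)
    (hR_pos : 0 ≤ R) (hR_sq : R * R = adjoint T * T)
    (hQ_pos : 0 ≤ Q) (hQ_sq : Q * Q = R)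
    (hpolar : T = U * R)
    (hU_unitary : adjoint U * U = 1 ∧ U * adjoint U = 1)
    (hnormal : adjoint (Q * U * Q) * (Q * U * Q) = (Q * U * Q) * adjoint (Q * U * Q))
    (X : H →L[ℂ] H) (hX : T * X = X * T) :
    U ^ 2 * X = X * U ^ 2 := by
  obtain ⟨hU1, hU2⟩ := hU_unitary
  have hUs : IsUnit (adjoint U) := ⟨⟨adjoint U, U, hU1, hU2⟩, rfl⟩
  have hR : R = adjoint U * T := by
    rw [hpolar, ← mul_assoc, hU1, one_mul]
  have hRu : IsUnit R := by
    rw [hR]; exact hUs.mul hT_inv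
  have hQu : IsUnit Q := by
    rw [← hQ_sq] at hRu
    exact isUnit_mul_self_iff.mp hRu
  have hQa : adjoint Q = Q := (IsSelfAdjoint.of_nonneg hQ_pos)
  obtain ⟨q, rfl⟩ := hQu
  set P : H →L[ℂ] H := (q : H →L[ℂ] H) with hP
  set Pinv : H →L[ℂ] H := ((q⁻¹ : (H →L[ℂ] H)ˣ) : H →L[ℂ] H) with hPinv
  have h1 : P * Pinv = 1 := q.mul_inv
  have h2 : Pinv * P = 1 := q.inv_mul
  have hNa : star (P * U * P) = P * adjoint U * P := by
    simp only [star_mul, star_eq_adjoint, hQa, mul_assoc]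
  have hXX : U * (P * P) * X = X * (U * (P * P)) := by
    rw [hQ_sq, ← hpolar]; exact hX
  have hN : IsStarNormal (P * U * P) := ⟨hnormal⟩
  have hc : Commute (P * X * Pinv) (P * U * P) := by
    change P * X * Pinv * (P * U * P) = P * U * P * (P * X * Pinv)
    calc P * X * Pinv * (P * U * P) = P * X * (Pinv * P) * U * P * (P * Pinv) := by
          rw [h1]; simp only [mul_assoc, mul_one]
      _ = P * (X * (U * (P * P))) * Pinv := by rw [h2]; simp only [mul_assoc, one_mul]
      _ = P * (U * (P * P) * X) * Pinv := by rw [hXX]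
      _ = _ := by simp only [mul_assoc]
  have hs : SemiconjBy (P * X * Pinv) (star (P * U * P)) (star (P * U * P)) :=
    SemiconjBy.star_right hN hN hc
  rw [hNa] at hs
  have hss : P * X * Pinv * (P * adjoint U * P) = P * adjoint U * P * (P * X * Pinv) := hs
  have hS : X * (adjoint U * R) = adjoint U * R * X := by
    rw [← hQ_sq]
    calc X * (adjoint U * (P * P))
        = (Pinv * P) * X * (Pinv * P) * adjoint U * P * P := by
          rw [h2]; simp only [mul_assoc, one_mul]
      _ = Pinv * (P * X * Pinv * (P * adjoint U * P)) * P := by simp only [mul_assoc]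
      _ = Pinv * (P * adjoint U * P * (P * X * Pinv)) * P := by rw [hss]
      _ = (Pinv * P) * adjoint U * P * P * X * (Pinv * P) := by simp only [mul_assoc]
      _ = _ := by rw [h2]; simp only [mul_assoc, one_mul, mul_one]
  have hUS : U ^ 2 * (adjoint U * R) = T := by
    rw [hpolar]
    calc U ^ 2 * (adjoint U * R) = U * (U * adjoint U) * R := by
          rw [pow_two]; simp only [mul_assoc]
      _ = U * R := by rw [hU2, mul_one]
  apply (hUs.mul hRu).mul_right_cancel
  rw [mul_assoc, hS, ← mul_assoc, hUS, mul_assoc, hUS, hX]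
end

section
/- Let H be a complex Hilbert space and let U be a unitary operator on H whose spectrum is contained in the arc { e^{iλ} : ε < λ < π − ε } for some ε > 0. If X is a bounded linear operator on H such that U^2 X = X U^2, then U X = X U. -/
open ContinuousLinearMap

/-- Let `U` be a unitary operator whose spectrum is contained in the arc
`{e^{iλ} : ε < λ < π - ε}` for some `ε > 0`. If `U² X = X U²`, then `U X = X U`. -/
theorem commutes_of_sq_commutes_of_spectrum_semicircle
    {H : Type*} [NormedAddCommGroup H] [InnerProductSpace ℂ H] [CompleteSpace H]
    (U X : H →L[ℂ] H)
    (hU_unitary : adjoint U * U = 1 ∧ U * adjoint U = 1)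
    (ε : ℝ) (hε : 0 < ε)
    (hspec : spectrum ℂ U ⊆
      {z : ℂ | ∃ lam : ℝ, ε < lam ∧ lam < Real.pi - ε ∧ z = Complex.exp (lam * Complex.I)})
    (hX : U ^ 2 * X = X * U ^ 2) :
    U * X = X * U := by
  obtain ⟨h1, h2⟩ := hU_unitary
  rw [← star_eq_adjoint] at h1 h2
  have hn : IsStarNormal U := ⟨h1.trans h2.symm⟩
  have hc : Commute (U ^ 2) X := hX
  have e1 : star (U ^ 2) * U ^ 2 = 1 := by
    rw [star_pow, ← (show Commute (star U) U from h1.trans h2.symm).mul_pow, h1, one_pow]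
  have e2 : U ^ 2 * star (U ^ 2) = 1 := by
    rw [star_pow, ← (show Commute U (star U) from h2.trans h1.symm).mul_pow, h2, one_pow]
  have hc' : Commute (star (U ^ 2)) X := by
    let u : (H →L[ℂ] H)ˣ := ⟨U ^ 2, star (U ^ 2), e2, e1⟩
    have : Commute (u : H →L[ℂ] H) X := hc
    exact this.units_inv_left
  let g : ℂ → ℂ := fun w => Complex.I * (-w) ^ (1 / 2 : ℂ)
  have hkey : ∀ lam : ℝ, -(Complex.exp (lam * Complex.I)) ^ 2
      = Complex.exp (((2 * lam - Real.pi : ℝ) : ℂ) * Complex.I) := by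
    intro lam
    push_cast
    rw [sub_mul, Complex.exp_sub, Complex.exp_pi_mul_I, ← Complex.exp_nat_mul]
    push_cast
    rw [div_neg, div_one]
    congr 2
    ring
  have hg : ∀ z ∈ spectrum ℂ U, g (z ^ 2) = z := by
    intro z hz
    obtain ⟨lam, l1, l2, rfl⟩ := hspec hz
    simp only [g]
    rw [hkey, Complex.cpow_def_of_ne_zero (Complex.exp_ne_zero _), Complex.log_exp]
    · have : Complex.I = Complex.exp ((Real.pi / 2 : ℂ) * Complex.I) := by
        rw [Complex.exp_pi_div_two_mul_I]
      nth_rw 1 [this]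
      rw [← Complex.exp_add]
      congr 1
      push_cast
      ring
    · rw [Complex.im_ofReal_mul, Complex.I_im, mul_one]
      linarith
    · rw [Complex.im_ofReal_mul, Complex.I_im, mul_one]
      linarith
  have hcont : ContinuousOn g ((fun z : ℂ => z ^ 2) '' spectrum ℂ U) := by
    rintro _ ⟨z, hz, rfl⟩
    obtain ⟨lam, l1, l2, rfl⟩ := hspec hz
    apply ContinuousAt.continuousWithinAt
    refine continuousAt_const.mul (ContinuousAt.cpow continuousAt_neg continuousAt_const ?_)
    simp only
    rw [hkey, Complex.mem_slitPlane_iff_arg, Complex.arg_exp_mul_I]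
    refine ⟨?_, Complex.exp_ne_zero _⟩
    rw [(toIocMod_eq_self _).2 ⟨by linarith, by linarith⟩]
    linarith
  have hU : cfc g (U ^ 2) = U := by
    rw [← cfc_comp_pow g 2 U hcont]
    rw [cfc_congr (g := id) (fun z hz => hg z hz)]
    exact cfc_id ℂ U
  have := Commute.cfc hc hc' g
  rw [hU] at this
  exact this
end

section
/- Let H be a complex Hilbert space, let T be an invertible bounded linear operator on H with polar decomposition T = U|T| (U unitary), suppose the spectrum of U is contained in some open semicircle { e^{iλ} : α + ε < λ < α + π − ε } (for some real α and ε > 0), and suppose the Aluthge transform T̃ = |T|^{1/2} U |T|^{1/2} is normal. Then for every bounded linear operator X on H, TX = XT implies T*X = XT*. -/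
open ContinuousLinearMap

/-- If the spectrum of a normal `u` lies in an open half plane through `0`, then `u` is a continuous
function of `u ^ 2`, so a selfadjoint element commuting with `u ^ 2` commutes with `u`. -/
lemma commute_of_commute_sq {A : Type*} [CStarAlgebra A] (u r : A) [IsStarNormal u]
    (hr : IsSelfAdjoint r) (c : ℂ) (hc : c ≠ 0)
    (hs : ∀ z ∈ spectrum ℂ u, 0 < (c * z).re) (h : Commute (u ^ 2) r) : Commute u r := by
  have hstar : Commute (star (u ^ 2)) r := by
    have := h.star_star
    rwa [hr.star_eq] at this
  have hcont : ContinuousOn (fun z : ℂ => c⁻¹ * (c ^ 2 * z) ^ (2⁻¹ : ℂ))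
      ((fun z : ℂ => z ^ 2) '' spectrum ℂ u) := by
    apply ContinuousOn.mul continuousOn_const
    apply ContinuousOn.cpow_const (by fun_prop)
    rintro _ ⟨z, hz, rfl⟩
    have h1 := hs z hz
    have h2 : c ^ 2 * z ^ 2 = (c * z) ^ 2 := by ring
    simp only [h2]
    generalize c * z = w at h1
    rw [Complex.mem_slitPlane_iff]
    by_cases hw : w.im = 0
    · left; simp [pow_two, hw]; positivity
    · right; simp [pow_two]; grind
  have key : cfc (fun z : ℂ => c⁻¹ * (c ^ 2 * z) ^ (2⁻¹ : ℂ)) (u ^ 2) = u := by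
    rw [← cfc_comp_pow (fun z : ℂ => c⁻¹ * (c ^ 2 * z) ^ (2⁻¹ : ℂ)) 2 u hcont]
    conv_rhs => rw [← cfc_id ℂ u]
    apply cfc_congr
    intro z hz
    have h2 : c ^ 2 * z ^ 2 = (c * z) ^ 2 := by ring
    simp only [h2, Complex.sq_cpow_two_inv (hs z hz), id]
    field_simp
  rw [← key]
  exact h.cfc hstar _


/-- Let `T` be invertible with polar decomposition `T = U|T|` (`U` unitary), suppose the
spectrum of `U` lies in an open semicircle `{e^{iλ} : α + ε < λ < α + π - ε}`, and suppose
the Aluthge transform `T̃ = |T|^{1/2} U |T|^{1/2}` is normal. Then `TX = XT` implies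
`T*X = XT*`. Here `R = |T|` and `Q = |T|^{1/2}`. -/
theorem fuglede_putnam_of_aluthge_normal_of_spectrum_semicircle
    {H : Type*} [NormedAddCommGroup H] [InnerProductSpace ℂ H] [CompleteSpace H]
    (T U R Q : H →L[ℂ] H)
    (hT_inv : IsUnit T)
    (hR_pos : 0 ≤ R) (hR_sq : R * R = adjoint T * T)
    (hQ_pos : 0 ≤ Q) (hQ_sq : Q * Q = R)
    (hpolar : T = U * R)
    (hU_unitary : adjoint U * U = 1 ∧ U * adjoint U = 1)
    (α ε : ℝ) (hε : 0 < ε)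
    (hspec : spectrum ℂ U ⊆
      {z : ℂ | ∃ lam : ℝ, α + ε < lam ∧ lam < α + Real.pi - ε ∧ z = Complex.exp (lam * Complex.I)})
    (hnormal : adjoint (Q * U * Q) * (Q * U * Q) = (Q * U * Q) * adjoint (Q * U * Q)) :
    ∀ X : H →L[ℂ] H, T * X = X * T → adjoint T * X = X * adjoint T := by
  intro X hX
  simp only [← star_eq_adjoint] at *
  obtain ⟨hU1, hU2⟩ := hU_unitary
  have hRs : star R = R := (IsSelfAdjoint.of_nonneg hR_pos).star_eq
  have hQs : star Q = Q := (IsSelfAdjoint.of_nonneg hQ_pos).star_eq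
  have hUu : IsUnit U := ⟨⟨U, star U, hU2, hU1⟩, rfl⟩
  have hRu : IsUnit R := by
    have : R = star U * T := by rw [hpolar, ← mul_assoc, hU1, one_mul]
    rw [this]
    exact hUu.star.mul hT_inv
  have hQu : IsUnit Q := by
    have hc : Commute Q Q := Commute.refl Q
    exact (hc.isUnit_mul_iff.1 (hQ_sq ▸ hRu)).1
  have h1 : star U * R * U = U * R * star U := by
    apply hQu.mul_left_cancel
    apply hQu.mul_right_cancel
    simp only [star_mul, hQs] at hnormal
    rw [← hQ_sq]
    simpa only [mul_assoc] using hnormal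
  have h2 : Commute (U ^ 2) R := by
    have e : R * U = U * (U * R * star U) := by
      rw [← h1, ← mul_assoc, ← mul_assoc, hU2, one_mul]
    have e2 : R * U * U = U * (U * R * star U) * U := by rw [e]
    have e3 : U * (U * R * star U) * U = U * U * R * (star U * U) := by
      simp only [mul_assoc]
    rw [e3, hU1, mul_one] at e2
    unfold Commute SemiconjBy
    rw [pow_two, ← e2, mul_assoc]
  have : IsStarNormal U := ⟨by unfold Commute SemiconjBy; rw [hU1, hU2]⟩
  have h3 : Commute U R := by
    refine commute_of_commute_sq U R hRs
      (Complex.exp ((-(α + Real.pi / 2) : ℝ) * Complex.I)) (Complex.exp_ne_zero _) ?_ h2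
    intro z hz
    obtain ⟨lam, hl1, hl2, rfl⟩ := hspec hz
    rw [← Complex.exp_add, ← add_mul, ← Complex.ofReal_add, Complex.exp_ofReal_mul_I_re]
    apply Real.cos_pos_of_mem_Ioo
    constructor <;> linarith
  have h4 : Commute (star U) R := by
    have := h3.star_star
    rwa [hRs] at this
  have : IsStarNormal T := by
    constructor
    have hTs : star T = R * star U := by rw [hpolar, star_mul, hRs]
    rw [hTs, hpolar]
    have hUU : Commute (star U) U := by unfold Commute SemiconjBy; rw [hU1, hU2]
    exact ((h3.symm.mul_right (Commute.refl R))).mul_left (hUU.mul_right h4)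
  have hs : SemiconjBy X T T := hX.symm
  exact (SemiconjBy.star_right inferInstance inferInstance hs).symm
end
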